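/- arXiv:2502.12569 — 2 statements merged into one kernel-verified Lean document; each statement's English description precedes it below -/
import Mathlib

section
/- For every tournament on n ≥ 2 players and every pair-value function f : N × N → ℕ, the maximum over all seedings σ of the pair-based tournament value V(σ) equals the maximum over all spanning caterpillar arborescences A of the tournament of Σ_{(i,j)∈A} f(i,j). -/
open Finset

noncomputable section
open scoped Classical

variable {P : Type*}

/-- The list of (winner, loser) pairs of the matches played in a Challenge the Champ
tournament whose current champ is `c` and whose remaining challengers, in order, are
the given list. -/
def ctcMatches (beats : P → P → Prop) : P → List P → List (P × P)
  | _, [] => []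
  | c, x :: xs =>
    if beats c x then (c, x) :: ctcMatches beats c xs
    else (x, c) :: ctcMatches beats x xs

/-- The final champ of a Challenge the Champ tournament whose current champ is `c` and
whose remaining challengers, in order, are the given list. -/
def ctcChamp (beats : P → P → Prop) : P → List P → P
  | c, [] => c
  | c, x :: xs => if beats c x then ctcChamp beats c xs else ctcChamp beats x xs

/-- The (winner, loser) pairs of matches of a Challenge the Champ tournament whose
seeding is given as a list of players. -/
def ctcMatchesL (beats : P → P → Prop) : List P → List (P × P)
  | [] => []
  | c :: xs => ctcMatches beats c xs

/-- The winner of a Challenge the Champ tournament seeded by a list of players. -/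
def ctcWinnerL (beats : P → P → Prop) : List P → Option P
  | [] => none
  | c :: xs => some (ctcChamp beats c xs)

/-- The (winner, loser) pairs of the matches played under the seeding `σ`. -/
def matchesOf (beats : P → P → Prop) {n : ℕ} (σ : Fin n → P) : List (P × P) :=
  ctcMatchesL beats (List.ofFn σ)

/-- The winner of the Challenge the Champ tournament under the seeding `σ`. -/
def winnerOf (beats : P → P → Prop) {n : ℕ} (σ : Fin n → P) : Option P :=
  ctcWinnerL beats (List.ofFn σ)

/-- `M_i(σ)`: the set of players who play a match against `i` and lose it. -/
def Mset [Fintype P] (beats : P → P → Prop) {n : ℕ} (σ : Fin n → P) (i : P) : Finset P :=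
  univ.filter fun j => (i, j) ∈ matchesOf beats σ

/-- `w_i(σ)`: the number of matches won by player `i`. -/
def wins [Fintype P] (beats : P → P → Prop) {n : ℕ} (σ : Fin n → P) (i : P) : ℕ :=
  (Mset beats σ i).card

/-- The player-popularity-based tournament value of a seeding: each match contributes
the popularity of its winner. -/
def Vpop [Fintype P] (beats : P → P → Prop) {n : ℕ} (σ : Fin n → P) (p : P → ℕ) : ℕ :=
  ∑ i, p i * wins beats σ i

/-- `A` is a spanning caterpillar arborescence of the tournament `beats` with root
`root`: every arc goes from a player to a player it beats; `root` has no incoming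
arc and every other player has exactly one; every player is reachable from `root`;
and the players with at least one outgoing arc, together with the arcs of `A`
joining them, form a directed path starting at `root`. -/
def IsSpanningCaterpillar (beats : P → P → Prop) (A : Set (P × P)) (root : P) : Prop :=
  (∀ a ∈ A, beats a.1 a.2) ∧
  (∀ i : P, (i, root) ∉ A) ∧
  (∀ j : P, j ≠ root → ∃! i : P, (i, j) ∈ A) ∧
  (∀ j : P, Relation.ReflTransGen (fun x y => (x, y) ∈ A) root j) ∧
  ∃ (t : ℕ) (b : Fin t → P),
    Function.Injective b ∧
    (∀ x : P, (∃ j, (x, j) ∈ A) ↔ ∃ i, b i = x) ∧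
    (∀ h : 0 < t, b ⟨0, h⟩ = root) ∧
    (∀ (i : ℕ) (h : i + 1 < t), (b ⟨i, Nat.lt_of_succ_lt h⟩, b ⟨i + 1, h⟩) ∈ A) ∧
    (∀ x y : P, (∃ j, (x, j) ∈ A) → (∃ j, (y, j) ∈ A) → (x, y) ∈ A →
      ∃ (i : ℕ) (h : i + 1 < t), x = b ⟨i, Nat.lt_of_succ_lt h⟩ ∧ y = b ⟨i + 1, h⟩)

theorem ctcMatches_append (beats : P → P → Prop) (c : P) (xs ys : List P) :
    ctcMatches beats c (xs ++ ys) =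
      ctcMatches beats c xs ++ ctcMatches beats (ctcChamp beats c xs) ys := by
  induction xs generalizing c with
  | nil => simp [ctcMatches, ctcChamp]
  | cons x xs ih => by_cases h : beats c x <;> simp [ctcMatches, ctcChamp, h, ih]

theorem ctcChamp_append (beats : P → P → Prop) (c : P) (xs ys : List P) :
    ctcChamp beats c (xs ++ ys) = ctcChamp beats (ctcChamp beats c xs) ys := by
  induction xs generalizing c with
  | nil => simp [ctcChamp]
  | cons x xs ih => by_cases h : beats c x <;> simp [ctcChamp, h, ih]

theorem ctcChamp_eq_self {beats : P → P → Prop} {c : P} {xs : List P}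
    (h : ∀ x ∈ xs, beats c x) : ctcChamp beats c xs = c := by
  induction xs with
  | nil => rfl
  | cons x xs ih => simp_all [ctcChamp]

theorem ctcMatches_eq_map {beats : P → P → Prop} {c : P} {xs : List P}
    (h : ∀ x ∈ xs, beats c x) : ctcMatches beats c xs = xs.map (Prod.mk c) := by
  induction xs with
  | nil => rfl
  | cons x xs ih => simp_all [ctcMatches]

/-- A caterpillar arborescence of `beats` with root `r` on the set `S` of players, whose
spine is presented as a list. -/
structure IsCaterpillarOn (beats : P → P → Prop) (S : Set P) (A : Set (P × P)) (r : P) :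
    Prop where
  beats_of_mem : ∀ i j, (i, j) ∈ A → beats i j
  left_mem : ∀ i j, (i, j) ∈ A → i ∈ S
  right_mem : ∀ i j, (i, j) ∈ A → j ∈ S
  root_mem : r ∈ S
  root_not_mem : ∀ i, (i, r) ∉ A
  existsUnique : ∀ j ∈ S, j ≠ r → ∃! i, (i, j) ∈ A
  reachable : ∀ j ∈ S, Relation.ReflTransGen (fun x y => (x, y) ∈ A) r j
  exists_spine : ∃ L : List P, L.Nodup ∧ (∀ x, (∃ j, (x, j) ∈ A) ↔ x ∈ L) ∧
    (∀ x ∈ L.head?, x = r) ∧ L.IsChain (fun x y => (x, y) ∈ A)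

namespace IsCaterpillarOn

variable {beats : P → P → Prop} {S : Set P} {A : Set (P × P)} {r : P}

theorem singleton (r : P) : IsCaterpillarOn beats {r} ∅ r where
  beats_of_mem := by simp
  left_mem := by simp
  right_mem := by simp
  root_mem := rfl
  root_not_mem := by simp
  existsUnique := by simp
  reachable := by rintro j rfl; exact .refl
  exists_spine := ⟨[], by simp⟩

theorem insert_leaf (h : IsCaterpillarOn beats S A r) {x : P} (hx : x ∉ S)
    (hb : beats r x) : IsCaterpillarOn beats (insert x S) (insert (r, x) A) r where
  beats_of_mem := by
    rintro i j (e | e)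
    · cases e; exact hb
    · exact h.beats_of_mem _ _ e
  left_mem := by
    rintro i j (e | e)
    · cases e; exact .inr h.root_mem
    · exact .inr (h.left_mem _ _ e)
  right_mem := by
    rintro i j (e | e)
    · cases e; exact .inl rfl
    · exact .inr (h.right_mem _ _ e)
  root_mem := .inr h.root_mem
  root_not_mem := by
    rintro i (e | e)
    · cases e; exact hx h.root_mem
    · exact h.root_not_mem _ e
  existsUnique := by
    rintro j (rfl | hj) hjr
    · refine ⟨r, .inl rfl, ?_⟩
      rintro i (e | e)
      · cases e; rfl
      · exact absurd (h.right_mem _ _ e) hx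
    · obtain ⟨i, hi, hu⟩ := h.existsUnique j hj hjr
      refine ⟨i, .inr hi, ?_⟩
      rintro k (e | e)
      · cases e; exact absurd hj hx
      · exact hu k e
  reachable := by
    rintro j (rfl | hj)
    · exact .single (.inl rfl)
    · exact Relation.ReflTransGen.mono (fun _ _ => .inr) _ _ (h.reachable j hj)
  exists_spine := by
    obtain ⟨L, hnd, hmem, hhd, hch⟩ := h.exists_spine
    rcases L with _ | ⟨y, L⟩
    · refine ⟨[r], by simp, fun z => ?_, by simp, by simp⟩
      have := hmem z
      simp_all
    · obtain rfl : y = r := hhd y rfl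
      refine ⟨y :: L, hnd, fun z => ?_, by simp, hch.imp fun _ _ => .inr⟩
      rw [← hmem]
      refine ⟨?_, fun ⟨j, hj⟩ => ⟨j, .inr hj⟩⟩
      rintro ⟨j, e | e⟩
      · cases e; exact (hmem y).2 (by simp)
      · exact ⟨j, e⟩

theorem insert_root (h : IsCaterpillarOn beats S A r) {x : P} (hx : x ∉ S)
    (hb : beats x r) : IsCaterpillarOn beats (insert x S) (insert (x, r) A) x where
  beats_of_mem := by
    rintro i j (e | e)
    · cases e; exact hb
    · exact h.beats_of_mem _ _ e
  left_mem := by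
    rintro i j (e | e)
    · cases e; exact .inl rfl
    · exact .inr (h.left_mem _ _ e)
  right_mem := by
    rintro i j (e | e)
    · cases e; exact .inr h.root_mem
    · exact .inr (h.right_mem _ _ e)
  root_mem := .inl rfl
  root_not_mem := by
    rintro i (e | e)
    · cases e; exact hx h.root_mem
    · exact hx (h.right_mem _ _ e)
  existsUnique := by
    rintro j (rfl | hj) hjx
    · exact absurd rfl hjx
    by_cases hjr : j = r
    · subst hjr
      refine ⟨x, .inl rfl, ?_⟩
      rintro i (e | e)
      · cases e; rfl
      · exact absurd e (h.root_not_mem i)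
    · obtain ⟨i, hi, hu⟩ := h.existsUnique j hj hjr
      refine ⟨i, .inr hi, ?_⟩
      rintro k (e | e)
      · cases e; exact absurd rfl hjr
      · exact hu k e
  reachable := by
    rintro j (rfl | hj)
    · exact .refl
    · exact .head (.inl rfl) (Relation.ReflTransGen.mono (fun _ _ => .inr) _ _ (h.reachable j hj))
  exists_spine := by
    obtain ⟨L, hnd, hmem, hhd, hch⟩ := h.exists_spine
    refine ⟨x :: L, ?_, fun z => ?_, by simp, ?_⟩
    · refine List.nodup_cons.2 ⟨fun hxL => ?_, hnd⟩
      obtain ⟨j, hj⟩ := (hmem x).2 hxL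
      exact hx (h.left_mem _ _ hj)
    · rw [List.mem_cons, ← hmem]
      constructor
      · rintro ⟨j, e | e⟩
        · cases e; exact .inl rfl
        · exact .inr ⟨j, e⟩
      · rintro (rfl | ⟨j, e⟩)
        · exact ⟨r, .inl rfl⟩
        · exact ⟨j, .inr e⟩
    · refine List.isChain_cons.2 ⟨fun y hy => ?_, hch.imp fun _ _ => .inr⟩
      rw [hhd y hy]
      exact .inl rfl

theorem isSpanningCaterpillar (h : IsCaterpillarOn beats Set.univ A r) :
    IsSpanningCaterpillar beats A r := by
  obtain ⟨L, hnd, hmem, hhd, hch⟩ := h.exists_spine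
  have hroot : ∀ h0 : 0 < L.length, L.get ⟨0, h0⟩ = r := fun h0 =>
    hhd _ (by simp [List.head?_eq_getElem?, h0])
  have harc : ∀ (i : ℕ) (hi : i + 1 < L.length),
      (L.get ⟨i, Nat.lt_of_succ_lt hi⟩, L.get ⟨i + 1, hi⟩) ∈ A :=
    fun i hi => List.isChain_iff_getElem.1 hch i hi
  refine ⟨fun a ha => h.beats_of_mem _ _ ha, h.root_not_mem,
    fun j => h.existsUnique j trivial, fun j => h.reachable j trivial,
    L.length, L.get, List.nodup_iff_injective_get.1 hnd,
    fun x => by rw [hmem, List.mem_iff_get], hroot, harc, ?_⟩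
  intro x y _ hy hxy
  obtain ⟨⟨k, hk⟩, rfl⟩ := List.mem_iff_get.1 ((hmem y).1 hy)
  rcases k with _ | k
  · rw [hroot hk] at hxy
    exact absurd hxy (h.root_not_mem x)
  · refine ⟨k, hk, ?_, rfl⟩
    have hne : L.get ⟨k + 1, hk⟩ ≠ r := fun e => h.root_not_mem x (e ▸ hxy)
    exact (h.existsUnique _ trivial hne).unique hxy (harc k hk)

end IsCaterpillarOn

/-- The matches of a Challenge the Champ tournament form a caterpillar arborescence rooted at
the final champ. -/
theorem isCaterpillarOn_ctcMatches {beats : P → P → Prop}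
    (htot : ∀ i j : P, i ≠ j → (beats i j ↔ ¬ beats j i)) (c : P) (xs : List P)
    (hnd : (c :: xs).Nodup) :
    IsCaterpillarOn beats {x | x ∈ c :: xs} {a | a ∈ ctcMatches beats c xs}
      (ctcChamp beats c xs) := by
  induction xs using List.reverseRecOn with
  | nil => simpa [ctcMatches, ctcChamp] using IsCaterpillarOn.singleton c
  | append_singleton xs x ih =>
    rw [← List.cons_append, List.nodup_append] at hnd
    obtain ⟨hnd, -, hx⟩ := hnd
    have ih := ih hnd
    have hx : x ∉ {x | x ∈ c :: xs} := fun hm => hx x hm x (by simp) rfl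
    have hS : {y | y ∈ c :: (xs ++ [x])} = insert x {x | x ∈ c :: xs} := by
      ext y; simp; tauto
    rw [hS, ctcChamp_append, ctcMatches_append]
    generalize ctcChamp beats c xs = w at ih ⊢
    have hwx : w ≠ x := fun e => hx (e ▸ ih.root_mem)
    by_cases hb : beats w x
    · convert ih.insert_leaf hx hb using 1
      · ext a; simp [ctcMatches, hb, or_comm]
      · simp [ctcChamp, hb]
    · convert ih.insert_root hx ((htot x w hwx.symm).2 hb) using 1
      · ext a; simp [ctcMatches, hb, or_comm]
      · simp [ctcChamp, hb]

theorem exists_isSpanningCaterpillar_ctcMatchesL {beats : P → P → Prop}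
    (htot : ∀ i j : P, i ≠ j → (beats i j ↔ ¬ beats j i)) {l : List P} (hne : l ≠ [])
    (hnd : l.Nodup) (hmem : ∀ x, x ∈ l) :
    ∃ r, IsSpanningCaterpillar beats {a | a ∈ ctcMatchesL beats l} r := by
  obtain ⟨c, xs, rfl⟩ := List.exists_cons_of_ne_nil hne
  have h := isCaterpillarOn_ctcMatches htot c xs hnd
  rw [Set.eq_univ_of_forall (s := {x | x ∈ c :: xs}) hmem] at h
  exact ⟨_, h.isSpanningCaterpillar⟩

theorem IsSpanningCaterpillar.eq_of_subset {beats : P → P → Prop} {A B : Set (P × P)} {r s : P}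
    (hA : IsSpanningCaterpillar beats A r) (hB : IsSpanningCaterpillar beats B s)
    (h : A ⊆ B) : A = B := by
  refine h.antisymm fun ⟨i, j⟩ hij => ?_
  have hrs : s = r := by
    by_contra hne
    obtain ⟨k, hk, -⟩ := hA.2.2.1 s hne
    exact hB.2.1 k (h hk)
  have hj : j ≠ s := fun e => hB.2.1 i (e ▸ hij)
  obtain ⟨k, hk, -⟩ := hA.2.2.1 j (hrs ▸ hj)
  rwa [(hB.2.2.1 j hj).unique hij (h hk)]

/-- The seeding that lets the players of `L` enter from last to first, each of them followed
by its own list of challengers. -/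
def blockSeeding (leaves : P → List P) (L : List P) : List P :=
  L.reverse.flatMap fun x => x :: leaves x

theorem blockSeeding_cons (leaves : P → List P) (b : P) (L : List P) :
    blockSeeding leaves (b :: L) = blockSeeding leaves L ++ b :: leaves b := by
  simp [blockSeeding]

theorem ctcMatchesL_blockSeeding {beats : P → P → Prop}
    (htot : ∀ i j : P, i ≠ j → (beats i j ↔ ¬ beats j i)) {A : Set (P × P)}
    (hA : ∀ a ∈ A, beats a.1 a.2) (hirr : ∀ i, ¬ beats i i) {leaves : P → List P}
    (hleaves : ∀ x, ∀ y ∈ leaves x, (x, y) ∈ A) {L : List P}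
    (hL : L.IsChain fun x y => (x, y) ∈ A) :
    (∀ a ∈ ctcMatchesL beats (blockSeeding leaves L), a ∈ A) ∧
      ctcWinnerL beats (blockSeeding leaves L) = L.head? := by
  induction L with
  | nil => simp [blockSeeding, ctcMatchesL, ctcWinnerL]
  | cons b L ih =>
    rw [List.isChain_cons] at hL
    obtain ⟨ihA, ihw⟩ := ih hL.2
    have hb : ∀ x ∈ leaves b, beats b x := fun x hx => hA _ (hleaves b x hx)
    rw [blockSeeding_cons]
    rcases hs : blockSeeding leaves L with _ | ⟨c, xs⟩
    · simp only [List.nil_append, ctcMatchesL, ctcWinnerL, ctcMatches_eq_map hb,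
        ctcChamp_eq_self hb, List.head?_cons, and_true]
      simpa using hleaves b
    · rw [hs] at ihA ihw
      have hbw := hL.1 (ctcChamp beats c xs) (by rw [← ihw]; simp [ctcWinnerL])
      have hbeats : beats b (ctcChamp beats c xs) := hA _ hbw
      have hnot : ¬ beats (ctcChamp beats c xs) b :=
        (htot _ _ fun e => hirr b (by rwa [← e] at hbeats)).1 hbeats
      simp only [List.cons_append, ctcMatchesL, ctcWinnerL, ctcMatches_append, ctcChamp_append,
        ctcMatches, ctcChamp, if_neg hnot, ctcMatches_eq_map hb, ctcChamp_eq_self hb,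
        List.head?_cons, and_true]
      intro a ha
      simp only [List.mem_append, List.mem_cons, List.mem_map] at ha
      rcases ha with ha | rfl | ⟨y, hy, rfl⟩
      · exact ihA a ha
      · exact hbw
      · exact hleaves b y hy

theorem IsSpanningCaterpillar.exists_seeding [Fintype P] [Nontrivial P] {beats : P → P → Prop}
    (hirr : ∀ i, ¬ beats i i) (htot : ∀ i j : P, i ≠ j → (beats i j ↔ ¬ beats j i))
    {A : Set (P × P)} {r : P} (h : IsSpanningCaterpillar beats A r) :
    ∃ l : List P, l.Nodup ∧ (∀ x, x ∈ l) ∧ {a | a ∈ ctcMatchesL beats l} = A := by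
  have ⟨hA, hr, huniq, _, t, b, hinj, hspine, h0, hch, _⟩ := h
  have ht : 0 < t := by
    obtain ⟨j, hj⟩ := exists_ne r
    obtain ⟨i, hi, -⟩ := huniq j hj
    obtain ⟨k, -⟩ := (hspine i).1 ⟨j, hi⟩
    exact k.pos
  have huniq' : ∀ {i i' j}, (i, j) ∈ A → (i', j) ∈ A → i = i' := fun {i i' j} hi hi' =>
    (huniq j fun e => hr i (e ▸ hi)).unique hi hi'
  let leaves : P → List P := fun x => (univ.filter fun y => (x, y) ∈ A ∧ ∀ k, b k ≠ y).toList
  have hleaves : ∀ x y, y ∈ leaves x ↔ (x, y) ∈ A ∧ ∀ k, b k ≠ y := by simp [leaves]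
  have hL : (List.ofFn b).IsChain fun x y => (x, y) ∈ A := by
    rw [List.isChain_iff_getElem]
    intro i hi
    simpa using hch i (by simpa using hi)
  have hnd : (blockSeeding leaves (List.ofFn b)).Nodup := by
    refine List.nodup_flatMap.2 ⟨fun x hx => ?_, ?_⟩
    · obtain ⟨k, rfl⟩ : ∃ k, b k = x := by simpa [List.mem_ofFn] using hx
      exact List.nodup_cons.2
        ⟨fun hk => ((hleaves _ _).1 hk).2 k rfl, Finset.nodup_toList _⟩
    · refine List.Pairwise.imp_of_mem ?_ (List.nodup_reverse.2 (List.nodup_ofFn.2 hinj))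
      intro x y hx hy hxy z hzx hzy
      obtain ⟨k, rfl⟩ : ∃ k, b k = x := by simpa [List.mem_ofFn] using hx
      obtain ⟨m, rfl⟩ : ∃ k, b k = y := by simpa [List.mem_ofFn] using hy
      rw [List.mem_cons, hleaves] at hzx hzy
      rcases hzx with rfl | hzx <;> rcases hzy with hzy | hzy
      · exact hxy hzy
      · exact hzy.2 k rfl
      · exact hzx.2 m hzy.symm
      · exact hxy (huniq' hzx.1 hzy.1)
  have hmem : ∀ x, x ∈ blockSeeding leaves (List.ofFn b) := by
    intro x
    simp only [blockSeeding, List.mem_flatMap, List.mem_reverse, List.mem_ofFn, List.mem_cons,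
      hleaves]
    by_cases hx : ∃ k, b k = x
    · exact ⟨x, hx, .inl rfl⟩
    · have hxr : x ≠ r := fun e => hx ⟨⟨0, ht⟩, (h0 ht).trans e.symm⟩
      obtain ⟨i, hi, -⟩ := huniq x hxr
      exact ⟨i, (hspine i).1 ⟨x, hi⟩, .inr ⟨hi, not_exists.1 hx⟩⟩
  obtain ⟨s, hs⟩ := exists_isSpanningCaterpillar_ctcMatchesL htot
    (List.ne_nil_of_mem (hmem r)) hnd hmem
  exact ⟨_, hnd, hmem, hs.eq_of_subset h
    (ctcMatchesL_blockSeeding htot hA hirr (fun x y hy => ((hleaves x y).1 hy).1) hL).1⟩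

theorem exists_equiv_ofFn_eq [Fintype P] {l : List P} (hnd : l.Nodup) (hmem : ∀ x, x ∈ l) :
    ∃ σ : Fin (Fintype.card P) ≃ P, List.ofFn σ = l := by
  let e := hnd.getEquivOfForallMemList l hmem
  have hcard : Fintype.card P = l.length := by
    rw [← Fintype.card_congr e, Fintype.card_fin]
  rw [hcard]
  exact ⟨e, List.ofFn_get l⟩

theorem sum_Mset [Fintype P] (beats : P → P → Prop) {n : ℕ} (σ : Fin n → P) (f : P → P → ℕ) :
    ∑ i, ∑ j ∈ Mset beats σ i, f i j =
      ∑ a ∈ (matchesOf beats σ).toFinset, f a.1 a.2 :=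
  (Finset.sum_finset_product _ univ (Mset beats σ) (by simp [Mset])
    (f := fun a => f a.1 a.2)).symm

/-- For any tournament on `n ≥ 2` players and any pair-value function `f`, the
maximum over all seedings of the pair-based tournament value
`V(σ) = ∑_i ∑_{j ∈ M_i(σ)} f i j` equals the maximum, over all spanning caterpillar
arborescences `A` of the tournament, of `∑_{(i,j) ∈ A} f i j`. -/
theorem ctc_pair_value_eq_max_caterpillar {P : Type*} [Fintype P]
    (hn : 2 ≤ Fintype.card P)
    (beats : P → P → Prop)
    (hirr : ∀ i, ¬ beats i i)
    (htot : ∀ i j : P, i ≠ j → (beats i j ↔ ¬ beats j i))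
    (f : P → P → ℕ) :
    ∃ v : ℕ,
      IsGreatest
        (Set.range fun σ : Fin (Fintype.card P) ≃ P =>
          ∑ i : P, ∑ j ∈ Mset beats (⇑σ) i, f i j) v ∧
      IsGreatest
        {s : ℕ | ∃ (A : Finset (P × P)) (root : P),
          IsSpanningCaterpillar beats (↑A : Set (P × P)) root ∧
          s = ∑ a ∈ A, f a.1 a.2} v := by
  have : Nontrivial P := Fintype.one_lt_card_iff_nontrivial.1 hn
  have hset : (Set.range fun σ : Fin (Fintype.card P) ≃ P =>
      ∑ i : P, ∑ j ∈ Mset beats (⇑σ) i, f i j) =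
      {s : ℕ | ∃ (A : Finset (P × P)) (root : P),
        IsSpanningCaterpillar beats (↑A : Set (P × P)) root ∧
        s = ∑ a ∈ A, f a.1 a.2} := by
    ext s
    constructor
    · rintro ⟨σ, rfl⟩
      have hmem : ∀ x, x ∈ List.ofFn σ := fun x => by
        simpa [List.mem_ofFn] using σ.surjective x
      obtain ⟨x⟩ : Nonempty P := inferInstance
      obtain ⟨r, hr⟩ := exists_isSpanningCaterpillar_ctcMatchesL htot
        (List.ne_nil_of_mem (hmem x)) (List.nodup_ofFn.2 σ.injective) hmem
      refine ⟨(matchesOf beats σ).toFinset, r, ?_, sum_Mset beats σ f⟩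
      rwa [List.coe_toFinset]
    · rintro ⟨A, r, hA, rfl⟩
      obtain ⟨l, hnd, hmem, hl⟩ := hA.exists_seeding hirr htot
      obtain ⟨σ, rfl⟩ := exists_equiv_ofFn_eq hnd hmem
      have hσ : (matchesOf beats σ).toFinset = A := by
        rw [← Finset.coe_inj, List.coe_toFinset, ← hl]
        rfl
      exact ⟨σ, by rw [← hσ]; exact sum_Mset beats σ f⟩
  rw [← hset]
  have hne : Nonempty (Fin (Fintype.card P) ≃ P) := ⟨(Fintype.equivFin P).symm⟩
  obtain ⟨v, hv⟩ := (Set.finite_range fun σ : Fin (Fintype.card P) ≃ P =>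
    ∑ i : P, ∑ j ∈ Mset beats (⇑σ) i, f i j).exists_maximal (Set.range_nonempty _)
  exact ⟨v, ⟨hv.1, fun w hw => (le_total w v).elim id (hv.2 hw)⟩,
    ⟨hv.1, fun w hw => (le_total w v).elim id (hv.2 hw)⟩⟩
end
end

section
/- Let G = (V, E) be a finite simple graph with |V| = n ≥ 6 in which every vertex has degree at least 1, and let k ∈ ℕ. Let N consist of a player p_v for each v ∈ V and a player p_e^ℓ for each e ∈ E and each ℓ ∈ {1,…,n²}, and let `beats` be any tournament relation on N satisfying: for every v ∈ V, e ∈ E, and ℓ, p_v beats p_e^ℓ if v is an endpoint of e, and p_e^ℓ beats p_v if v is not an endpoint of e. For a seeding σ, define its value as Σ_{v∈V} max(0, w_{p_v}(σ) − (d(v)·n² − 2n) + 1), where d(v) is the degree of v in G. Then there exists a seeding of value at least 2nk if and only if G has an independent set of size k. -/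
open Finset

noncomputable section
open scoped Classical

variable {P : Type*}

/-! ### Matches of a Challenge the Champ tournament -/

theorem ctcMatches_loser_mem (beats : P → P → Prop) (xs : List P) (c i j : P)
    (h : (i, j) ∈ ctcMatches beats c xs) : j ∈ c :: xs := by
  induction xs generalizing c with
  | nil => simp [ctcMatches] at h
  | cons x xs ih =>
    rw [ctcMatches] at h
    split_ifs at h with hb
    · rcases List.mem_cons.1 h with h | h
      · simp_all
      · have := ih c h
        simp only [List.mem_cons] at this ⊢
        tauto
    · rcases List.mem_cons.1 h with h | h
      · simp_all
      · have := ih x h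
        simp only [List.mem_cons] at this ⊢
        tauto

theorem ctcMatches_beats {beats : P → P → Prop}
    (htot : ∀ i j, i ≠ j → ¬ beats i j → beats j i) (xs : List P) (c i j : P)
    (hnd : (c :: xs).Nodup) (h : (i, j) ∈ ctcMatches beats c xs) : beats i j := by
  induction xs generalizing c with
  | nil => simp [ctcMatches] at h
  | cons x xs ih =>
    have hcx : c ≠ x := by rintro rfl; simp at hnd
    have h1 : (c :: xs).Nodup := by
      simp only [List.nodup_cons, List.mem_cons] at hnd ⊢; tauto
    have h2 : (x :: xs).Nodup := (List.nodup_cons.1 hnd).2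
    rw [ctcMatches] at h
    split_ifs at h with hb
    · rcases List.mem_cons.1 h with h | h
      · simp_all
      · exact ih c h1 h
    · rcases List.mem_cons.1 h with h | h
      · obtain ⟨rfl, rfl⟩ := Prod.mk.inj h
        exact htot _ _ hcx hb
      · exact ih x h2 h

theorem ctcMatches_winner_unique {beats : P → P → Prop} (xs : List P) (c i i' j : P)
    (hnd : (c :: xs).Nodup) (h : (i, j) ∈ ctcMatches beats c xs)
    (h' : (i', j) ∈ ctcMatches beats c xs) : i = i' := by
  induction xs generalizing c with
  | nil => simp [ctcMatches] at h
  | cons x xs ih =>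
    have hcx : c ≠ x := by rintro rfl; simp at hnd
    have h1 : (c :: xs).Nodup := by
      simp only [List.nodup_cons, List.mem_cons] at hnd ⊢; tauto
    have h2 : (x :: xs).Nodup := (List.nodup_cons.1 hnd).2
    have hc : c ∉ xs := (List.nodup_cons.1 h1).1
    have hx : x ∉ xs := (List.nodup_cons.1 h2).1
    rw [ctcMatches] at h h'
    split_ifs at h h' with hb
    · have key : ∀ a, (a, x) ∉ ctcMatches beats c xs := fun a ha => by
        rcases List.mem_cons.1 (ctcMatches_loser_mem _ _ _ _ _ ha) with e | e
        exacts [hcx e.symm, hx e]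
      rcases List.mem_cons.1 h with e | e <;> rcases List.mem_cons.1 h' with e' | e'
      · simp_all
      · obtain ⟨rfl, rfl⟩ := Prod.mk.inj e; exact absurd e' (key _)
      · obtain ⟨rfl, rfl⟩ := Prod.mk.inj e'; exact absurd e (key _)
      · exact ih c h1 e e'
    · have key : ∀ a, (a, c) ∉ ctcMatches beats x xs := fun a ha => by
        rcases List.mem_cons.1 (ctcMatches_loser_mem _ _ _ _ _ ha) with e | e
        exacts [hcx e, hc e]
      rcases List.mem_cons.1 h with e | e <;> rcases List.mem_cons.1 h' with e' | e'
      · simp_all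
      · obtain ⟨rfl, rfl⟩ := Prod.mk.inj e; exact absurd e' (key _)
      · obtain ⟨rfl, rfl⟩ := Prod.mk.inj e'; exact absurd e (key _)
      · exact ih x h2 e e'

theorem matchesOf_beats {beats : P → P → Prop}
    (htot : ∀ i j, i ≠ j → ¬ beats i j → beats j i) {n : ℕ} {σ : Fin n → P}
    (hσ : Function.Injective σ) {i j : P} (h : (i, j) ∈ matchesOf beats σ) : beats i j := by
  have hnd := List.nodup_ofFn.2 hσ
  rw [matchesOf] at h
  revert h hnd
  cases List.ofFn σ with
  | nil => intro h; simp [ctcMatchesL] at h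
  | cons c xs => intro h hnd; exact ctcMatches_beats htot xs c i j hnd h

theorem matchesOf_winner_unique {beats : P → P → Prop} {n : ℕ} {σ : Fin n → P}
    (hσ : Function.Injective σ) {i i' j : P} (h : (i, j) ∈ matchesOf beats σ)
    (h' : (i', j) ∈ matchesOf beats σ) : i = i' := by
  have hnd := List.nodup_ofFn.2 hσ
  rw [matchesOf] at h h'
  revert h h' hnd
  cases List.ofFn σ with
  | nil => intro h; simp [ctcMatchesL] at h
  | cons c xs => intro h h' hnd; exact ctcMatches_winner_unique xs c i i' j hnd h h'

theorem mem_Mset [Fintype P] {beats : P → P → Prop} {n : ℕ} {σ : Fin n → P} {i j : P} :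
    j ∈ Mset beats σ i ↔ (i, j) ∈ matchesOf beats σ := by
  simp [Mset]

theorem disjoint_Mset [Fintype P] {beats : P → P → Prop} {n : ℕ} {σ : Fin n → P}
    (hσ : Function.Injective σ) {i i' : P} (h : i ≠ i') :
    Disjoint (Mset beats σ i) (Mset beats σ i') :=
  Finset.disjoint_left.2 fun _ hj hj' =>
    h (matchesOf_winner_unique hσ (mem_Mset.1 hj) (mem_Mset.1 hj'))

theorem exists_seeding_of_list [Fintype P] (L : List P) (hnd : L.Nodup) (hL : ∀ x, x ∈ L) :
    ∃ σ : Fin (Fintype.card P) ≃ P, List.ofFn σ = L := by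
  have hlen : L.length = Fintype.card P := by
    simpa using Fintype.card_congr (hnd.getEquivOfForallMemList L hL)
  refine ⟨(finCongr hlen.symm).trans (hnd.getEquivOfForallMemList L hL), ?_⟩
  apply List.ext_getElem
  · simp [hlen]
  · intro i h1 h2
    simp

/-! ### Seedings in which prescribed players beat prescribed sets of opponents -/

/-- A stretch of a seeding meant to let `p` beat every player of the given list: the first
of them dethrones the current champ, then `p` enters, then the others follow. -/
def ctcBlock (p : P) : List P → List P
  | [] => [p]
  | h :: t => h :: p :: t

theorem ctcBlock_perm (p : P) (l : List P) : (ctcBlock p l).Perm (p :: l) := by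
  cases l with
  | nil => exact List.Perm.refl _
  | cons h t => exact List.Perm.swap _ _ _

theorem mem_ctcMatches_append {beats : P → P → Prop} {p : P} {t : List P}
    (ht : ∀ x ∈ t, beats p x) (r : List P) (m : P × P) :
    m ∈ ctcMatches beats p (t ++ r) ↔ (∃ x ∈ t, m = (p, x)) ∨ m ∈ ctcMatches beats p r := by
  induction t with
  | nil => simp
  | cons a t ih =>
    have ha := ht a (by simp)
    have := ih fun x hx => ht x (by simp [hx])
    simp only [List.cons_append, ctcMatches, ha, if_true, List.mem_cons, this]
    simp [or_assoc]

theorem mem_ctcMatches_flatMap_ctcBlock {ι : Type*} {beats : P → P → Prop}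
    (hasymm : ∀ i j, beats i j → ¬ beats j i) (p : ι → P) (E : ι → List P)
    (hE : ∀ v, E v ≠ []) (hpE : ∀ v, ∀ x ∈ E v, beats (p v) x) (r : List P)
    (vs : List ι) (c : P) (hc : ∀ v ∈ vs, ∀ x ∈ E v, beats x c)
    (hvs : vs.Pairwise fun u v => ∀ x ∈ E v, beats x (p u)) :
    ∀ v ∈ vs, ∀ x ∈ E v,
      (p v, x) ∈ ctcMatches beats c (vs.flatMap (fun v => ctcBlock (p v) (E v)) ++ r) := by
  induction vs generalizing c with
  | nil => simp
  | cons w vs ih =>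
    obtain ⟨h, t, hw⟩ := List.exists_cons_of_ne_nil (hE w)
    have hb : ¬ beats c h := hasymm _ _ (hc w (by simp) h (by simp [hw]))
    have hb' : ¬ beats h (p w) := hasymm _ _ (hpE w h (by simp [hw]))
    have ht : ∀ x ∈ t, beats (p w) x := fun x hx => hpE w x (by simp [hw, hx])
    rw [List.pairwise_cons] at hvs
    have ih' := ih (p w) (fun v hv => hvs.1 v hv) hvs.2
    intro v hv x hx
    simp only [List.flatMap_cons, hw, ctcBlock, List.cons_append, List.append_assoc, ctcMatches,
      hb, hb', if_false, List.mem_cons, mem_ctcMatches_append ht]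
    rcases List.mem_cons.1 hv with rfl | hv
    · rw [hw] at hx
      rcases List.mem_cons.1 hx with rfl | hx
      · simp
      · exact Or.inr (Or.inr (Or.inl ⟨x, hx, rfl⟩))
    · exact Or.inr (Or.inr (Or.inr (ih' v hv x hx)))

theorem mem_ctcMatchesL_flatMap_ctcBlock {ι : Type*} {beats : P → P → Prop}
    (hasymm : ∀ i j, beats i j → ¬ beats j i) (p : ι → P) (E : ι → List P)
    (hE : ∀ v, E v ≠ []) (hpE : ∀ v, ∀ x ∈ E v, beats (p v) x) (r : List P)
    (vs : List ι) (hvs : vs.Pairwise fun u v => ∀ x ∈ E v, beats x (p u)) :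
    ∀ v ∈ vs, ∀ x ∈ E v,
      (p v, x) ∈ ctcMatchesL beats (vs.flatMap (fun v => ctcBlock (p v) (E v)) ++ r) := by
  cases vs with
  | nil => simp
  | cons w vs =>
    obtain ⟨h, t, hw⟩ := List.exists_cons_of_ne_nil (hE w)
    have hb' : ¬ beats h (p w) := hasymm _ _ (hpE w h (by simp [hw]))
    have ht : ∀ x ∈ t, beats (p w) x := fun x hx => hpE w x (by simp [hw, hx])
    rw [List.pairwise_cons] at hvs
    have ih' := mem_ctcMatches_flatMap_ctcBlock hasymm p E hE hpE r vs (p w)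
      (fun v hv => hvs.1 v hv) hvs.2
    intro v hv x hx
    simp only [List.flatMap_cons, hw, ctcBlock, List.cons_append, List.append_assoc, ctcMatchesL,
      ctcMatches, hb', if_false, List.mem_cons, mem_ctcMatches_append ht]
    rcases List.mem_cons.1 hv with rfl | hv
    · rw [hw] at hx
      rcases List.mem_cons.1 hx with rfl | hx
      · simp
      · exact Or.inr (Or.inl ⟨x, hx, rfl⟩)
    · exact Or.inr (Or.inr (ih' v hv x hx))

/-- If the players `p v` for `v ∈ I` each beat a nonempty set `E v` of opponents, these sets
are pairwise disjoint, and every member of `E v` beats `p u` for `u ≠ v`, then a single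
seeding lets every `p v` win against all of `E v`. -/
theorem exists_seeding_forall_subset_Mset [Fintype P] {ι : Type*} {beats : P → P → Prop}
    (hasymm : ∀ i j, beats i j → ¬ beats j i) (p : ι → P) (hp : Function.Injective p)
    (E : ι → Finset P) (hE : ∀ v, (E v).Nonempty) (hpE : ∀ v, ∀ x ∈ E v, beats (p v) x)
    (hnotp : ∀ u v, p u ∉ E v) (I : Finset ι)
    (hI : ∀ u ∈ I, ∀ v ∈ I, u ≠ v → ∀ x ∈ E v, beats x (p u)) :
    ∃ σ : Fin (Fintype.card P) ≃ P, ∀ v ∈ I, E v ⊆ Mset beats σ (p v) := by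
  set L₁ := I.toList.flatMap (fun v => ctcBlock (p v) (E v).toList) with hL₁
  have hmem : ∀ v x, x ∈ ctcBlock (p v) (E v).toList ↔ x = p v ∨ x ∈ E v := fun v x => by
    rw [(ctcBlock_perm _ _).mem_iff]; simp
  have hnd : L₁.Nodup := by
    rw [hL₁, List.nodup_flatMap]
    constructor
    · intro v _
      rw [(ctcBlock_perm _ _).nodup_iff]
      simp [hnotp, Finset.nodup_toList]
    · refine (Finset.nodup_toList I).imp_of_mem ?_
      intro u v hu hv huv
      rw [Finset.mem_toList] at hu hv
      rw [Function.onFun, List.disjoint_left]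
      intro x hxu hxv
      rw [hmem] at hxu hxv
      rcases hxu with rfl | hxu <;> rcases hxv with hx | hxv
      · exact huv (hp hx)
      · exact hnotp _ _ hxv
      · exact hnotp _ _ (hx ▸ hxu)
      · exact hasymm _ _ (hpE u x hxu) (hI u hu v hv huv x hxv)
  obtain ⟨σ, hσ⟩ := exists_seeding_of_list (L₁ ++ (univ \ L₁.toFinset).toList)
    (List.nodup_append'.2 ⟨hnd, Finset.nodup_toList _, by
      rw [List.disjoint_left]; intro x hx; simp [hx]⟩)
    (fun x => by by_cases hx : x ∈ L₁ <;> simp [hx])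
  refine ⟨σ, fun v hv x hx => ?_⟩
  rw [mem_Mset, matchesOf, hσ]
  refine mem_ctcMatchesL_flatMap_ctcBlock hasymm p (fun v => (E v).toList)
    (fun v => by simpa [Finset.nonempty_iff_ne_empty] using hE v)
    (fun v x hx => hpE v x (by simpa using hx)) _ _ ?_ v
    (by simpa using hv) x (by simpa using hx)
  refine (Finset.nodup_toList I).imp_of_mem ?_
  intro u v hu hv huv x hx
  exact hI u (by simpa using hu) v (by simpa using hv) huv x (by simpa using hx)

/-! ### The players of the reduction -/

section Reduction

variable {V : Type*} (G : SimpleGraph V) [Fintype G.edgeSet]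

/-- The players attached to the edges incident to `v`, with `m` players per edge. -/
def incidentPlayers (m : ℕ) (v : V) : Finset (V ⊕ ({e // e ∈ G.edgeFinset} × Fin m)) :=
  ((univ.filter fun e : {e // e ∈ G.edgeFinset} => v ∈ (e : Sym2 V)) ×ˢ univ).map
    Function.Embedding.inr

/-- The players attached to the edge `e`. -/
def edgePlayers (m : ℕ) (e : {e // e ∈ G.edgeFinset}) :
    Finset (V ⊕ ({e // e ∈ G.edgeFinset} × Fin m)) :=
  (({e} : Finset _) ×ˢ univ).map Function.Embedding.inr

variable {G}

theorem inl_notMem_incidentPlayers {m : ℕ} (u v : V) : Sum.inl u ∉ incidentPlayers G m v := by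
  simp [incidentPlayers]

theorem inr_mem_incidentPlayers {m : ℕ} {v : V} {e : {e // e ∈ G.edgeFinset}} {l : Fin m} :
    Sum.inr (e, l) ∈ incidentPlayers G m v ↔ v ∈ (e : Sym2 V) := by
  simp [incidentPlayers]

theorem card_edgePlayers (m : ℕ) (e : {e // e ∈ G.edgeFinset}) :
    (edgePlayers G m e).card = m := by
  simp [edgePlayers]

theorem edgePlayers_subset_incidentPlayers {m : ℕ} {v : V} {e : {e // e ∈ G.edgeFinset}}
    (h : v ∈ (e : Sym2 V)) : edgePlayers G m e ⊆ incidentPlayers G m v := by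
  refine map_subset_map.2 (product_subset_product_left ?_)
  simpa using h

theorem card_incidentPlayers [Fintype V] [DecidableRel G.Adj] (m : ℕ) (v : V) :
    (incidentPlayers G m v).card = G.degree v * m := by
  rw [incidentPlayers, card_map, card_product, card_univ, Fintype.card_fin,
    ← G.card_incidenceFinset_eq_degree v]
  congr 1
  refine card_bij (fun e _ => (e : Sym2 V)) ?_ ?_ ?_
  · intro e he
    rw [SimpleGraph.mem_incidenceFinset]
    exact ⟨SimpleGraph.mem_edgeFinset.1 e.2, (mem_filter.1 he).2⟩
  · intro a _ b _ h
    exact Subtype.ext h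
  · intro e he
    rw [SimpleGraph.mem_incidenceFinset] at he
    exact ⟨⟨e, SimpleGraph.mem_edgeFinset.2 he.1⟩, by simpa using he.2, rfl⟩

variable [Fintype V] {m N : ℕ}
  {beats : (V ⊕ ({e // e ∈ G.edgeFinset} × Fin m)) →
    (V ⊕ ({e // e ∈ G.edgeFinset} × Fin m)) → Prop}
  {σ : Fin N → (V ⊕ ({e // e ∈ G.edgeFinset} × Fin m))}

/-- The vertices whose players lose a match to the player of `v`. -/
def beatenVertices (beats : (V ⊕ ({e // e ∈ G.edgeFinset} × Fin m)) →
    (V ⊕ ({e // e ∈ G.edgeFinset} × Fin m)) → Prop)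
    (σ : Fin N → (V ⊕ ({e // e ∈ G.edgeFinset} × Fin m))) (v : V) : Finset V :=
  univ.filter fun u => Sum.inl u ∈ Mset beats σ (Sum.inl v)

theorem card_beatenVertices_lt (hσ : Function.Injective σ) (hirr : ∀ i, ¬ beats i i)
    (htot : ∀ i j, i ≠ j → (beats i j ↔ ¬ beats j i)) (v : V) :
    (beatenVertices beats σ v).card < Fintype.card V := by
  refine card_lt_univ_of_notMem (x := v) fun h => ?_
  exact hirr _ (matchesOf_beats (fun i j hij h => (htot j i hij.symm).2 h) hσ
    (mem_Mset.1 (mem_filter.1 h).2))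

theorem sum_card_beatenVertices_le (hσ : Function.Injective σ) :
    ∑ v, (beatenVertices beats σ v).card ≤ Fintype.card V := by
  rw [← card_biUnion]
  · exact card_le_univ _
  · intro u _ v _ huv
    refine Finset.disjoint_left.2 fun x hx hx' => ?_
    exact Finset.disjoint_left.1 (disjoint_Mset hσ (Sum.inl_injective.ne huv))
      (mem_filter.1 hx).2 (mem_filter.1 hx').2

theorem Mset_inl_subset (hσ : Function.Injective σ)
    (htot : ∀ i j, i ≠ j → (beats i j ↔ ¬ beats j i))
    (hve : ∀ (v : V) (e : {e // e ∈ G.edgeFinset}) (l : Fin m),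
      v ∉ (e : Sym2 V) → beats (Sum.inr (e, l)) (Sum.inl v)) (v : V) :
    Mset beats σ (Sum.inl v) ⊆
      (beatenVertices beats σ v).map Function.Embedding.inl ∪ incidentPlayers G m v := by
  intro x hx
  have hb := matchesOf_beats (fun i j hij h => (htot j i hij.symm).2 h) hσ (mem_Mset.1 hx)
  rw [mem_union]
  rcases x with u | ⟨e, l⟩
  · exact Or.inl (mem_map.2 ⟨u, mem_filter.2 ⟨mem_univ _, hx⟩, rfl⟩)
  · refine Or.inr (inr_mem_incidentPlayers.2 ?_)
    by_contra h
    exact (htot _ _ (by simp)).1 hb (hve v e l h)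

variable [DecidableRel G.Adj]

theorem wins_inl_le (hσ : Function.Injective σ)
    (htot : ∀ i j, i ≠ j → (beats i j ↔ ¬ beats j i))
    (hve : ∀ (v : V) (e : {e // e ∈ G.edgeFinset}) (l : Fin m),
      v ∉ (e : Sym2 V) → beats (Sum.inr (e, l)) (Sum.inl v)) (v : V) :
    wins beats σ (Sum.inl v) ≤ (beatenVertices beats σ v).card + G.degree v * m := by
  refine (card_le_card (Mset_inl_subset hσ htot hve v)).trans ((card_union_le _ _).trans ?_)
  rw [card_map, card_incidentPlayers]

/-- The wins of the player of an endpoint `v` of `e` that do not come from the players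
attached to `e` are bounded by those against vertices and other incident edges. -/
theorem wins_inl_add_le (hσ : Function.Injective σ) (hirr : ∀ i, ¬ beats i i)
    (htot : ∀ i j, i ≠ j → (beats i j ↔ ¬ beats j i))
    (hve : ∀ (v : V) (e : {e // e ∈ G.edgeFinset}) (l : Fin m),
      v ∉ (e : Sym2 V) → beats (Sum.inr (e, l)) (Sum.inl v))
    {v : V} {e : {e // e ∈ G.edgeFinset}} (hv : v ∈ (e : Sym2 V)) :
    wins beats σ (Sum.inl v) + m + 1 ≤ Fintype.card V + G.degree v * m +
      (Mset beats σ (Sum.inl v) ∩ edgePlayers G m e).card := by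
  have hsub : Mset beats σ (Sum.inl v) ⊆ (beatenVertices beats σ v).map Function.Embedding.inl ∪
      (incidentPlayers G m v \ edgePlayers G m e) ∪
      (Mset beats σ (Sum.inl v) ∩ edgePlayers G m e) := by
    intro x hx
    have := Mset_inl_subset hσ htot hve v hx
    simp only [mem_union, mem_sdiff, mem_inter] at this ⊢
    tauto
  have h1 := (card_le_card hsub).trans (card_union_le _ _)
  have h2 := card_union_le ((beatenVertices beats σ v).map Function.Embedding.inl)
    (incidentPlayers G m v \ edgePlayers G m e)
  have h3 := card_sdiff_add_card_eq_card (edgePlayers_subset_incidentPlayers (m := m) hv)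
  rw [card_incidentPlayers, card_edgePlayers] at h3
  rw [card_map] at h2
  have h4 := card_beatenVertices_lt hσ hirr htot v
  rw [wins]
  omega

/-- Two adjacent vertices cannot both have all but few of their possible wins. -/
theorem not_adj_of_le_wins (hσ : Function.Injective σ) (hirr : ∀ i, ¬ beats i i)
    (htot : ∀ i j, i ≠ j → (beats i j ↔ ¬ beats j i))
    (hve : ∀ (v : V) (e : {e // e ∈ G.edgeFinset}) (l : Fin m),
      v ∉ (e : Sym2 V) → beats (Sum.inr (e, l)) (Sum.inl v))
    (hm : 6 * Fintype.card V ≤ m) {u v : V}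
    (hu : G.degree u * m ≤ wins beats σ (Sum.inl u) + 2 * Fintype.card V)
    (hv : G.degree v * m ≤ wins beats σ (Sum.inl v) + 2 * Fintype.card V) : ¬ G.Adj u v := by
  intro h
  let e : {e // e ∈ G.edgeFinset} := ⟨s(u, v), SimpleGraph.mem_edgeFinset.2 h⟩
  have h1 := wins_inl_add_le (e := e) hσ hirr htot hve (Sym2.mem_mk_left u v)
  have h2 := wins_inl_add_le (e := e) hσ hirr htot hve (Sym2.mem_mk_right u v)
  have h3 : (Mset beats σ (Sum.inl u) ∩ edgePlayers G m e).card +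
      (Mset beats σ (Sum.inl v) ∩ edgePlayers G m e).card ≤ m := by
    rw [← card_union_of_disjoint]
    · exact (card_le_card (union_subset inter_subset_right inter_subset_right)).trans
        (card_edgePlayers m e).le
    · exact (disjoint_Mset hσ (Sum.inl_injective.ne h.ne)).mono inter_subset_left
        inter_subset_left
  omega

end Reduction

/-- Hardness reduction for linear-after-threshold win-count-based values: from a
simple graph `G` on `n ≥ 6` vertices with minimum degree at least 1, take a player
`p_v` for each vertex `v` and players `p_e^ℓ`, `ℓ ∈ {1,…,n²}`, for each edge `e`,
where `p_v` beats `p_e^ℓ` iff `v` is an endpoint of `e`.  The value of a seeding is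
`∑_v max(0, w_{p_v}(σ) − (d(v)·n² − 2n) + 1)` (expressed below with truncated
subtraction on `ℕ`).  Some seeding attains value at least `2nk` iff `G` has an
independent set of size `k`. -/
theorem ctc_linear_after_threshold_reduction {V : Type*} [Fintype V] [DecidableEq V]
    (G : SimpleGraph V) [DecidableRel G.Adj] [Fintype G.edgeSet]
    (hn : 6 ≤ Fintype.card V) (hdeg : ∀ v : V, 1 ≤ G.degree v) (k : ℕ)
    (beats : (V ⊕ ({e // e ∈ G.edgeFinset} × Fin (Fintype.card V ^ 2))) →
             (V ⊕ ({e // e ∈ G.edgeFinset} × Fin (Fintype.card V ^ 2))) → Prop)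
    (hirr : ∀ i, ¬ beats i i)
    (htot : ∀ i j, i ≠ j → (beats i j ↔ ¬ beats j i))
    (hve : ∀ (v : V) (e : {e // e ∈ G.edgeFinset}) (ℓ : Fin (Fintype.card V ^ 2)),
      (v ∈ (e : Sym2 V) → beats (Sum.inl v) (Sum.inr (e, ℓ))) ∧
      (v ∉ (e : Sym2 V) → beats (Sum.inr (e, ℓ)) (Sum.inl v))) :
    (∃ σ : Fin (Fintype.card (V ⊕ ({e // e ∈ G.edgeFinset} × Fin (Fintype.card V ^ 2)))) ≃
        (V ⊕ ({e // e ∈ G.edgeFinset} × Fin (Fintype.card V ^ 2))),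
      2 * Fintype.card V * k ≤
        ∑ v : V, (wins beats (⇑σ) (Sum.inl v) + 1 -
          (G.degree v * Fintype.card V ^ 2 - 2 * Fintype.card V))) ↔
    (∃ I : Finset V, I.card = k ∧ ∀ u ∈ I, ∀ w ∈ I, ¬ G.Adj u w) := by
  have hasymm : ∀ i j, beats i j → ¬ beats j i := fun i j h =>
    (htot i j (by rintro rfl; exact hirr _ h)).1 h
  have hve' : ∀ (v : V) (e : {e // e ∈ G.edgeFinset}) (ℓ : Fin (Fintype.card V ^ 2)),
      v ∉ (e : Sym2 V) → beats (Sum.inr (e, ℓ)) (Sum.inl v) := fun v e ℓ => (hve v e ℓ).2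
  have hn2 : 6 * Fintype.card V ≤ Fintype.card V ^ 2 := by nlinarith
  have hdn : ∀ v, Fintype.card V ^ 2 ≤ G.degree v * Fintype.card V ^ 2 := fun v =>
    Nat.le_mul_of_pos_left _ (hdeg v)
  constructor
  · rintro ⟨σ, hσ⟩
    have hinj := σ.injective
    set S : Finset V := univ.filter fun v =>
      G.degree v * Fintype.card V ^ 2 ≤ wins beats σ (Sum.inl v) + 2 * Fintype.card V with hS
    have hind : ∀ u ∈ S, ∀ w ∈ S, ¬ G.Adj u w := fun u hu w hw =>
      not_adj_of_le_wins hinj hirr htot hve' hn2 (mem_filter.1 hu).2 (mem_filter.1 hw).2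
    have hbound : ∀ v, wins beats σ (Sum.inl v) + 1 -
        (G.degree v * Fintype.card V ^ 2 - 2 * Fintype.card V) ≤
        (if v ∈ S then 2 * Fintype.card V + 1 else 0) + (beatenVertices beats σ v).card := by
      intro v
      have h1 := wins_inl_le hinj htot hve' v
      have h2 := hdn v
      by_cases hv : v ∈ S
      · rw [if_pos hv]; omega
      · rw [if_neg hv]
        have h3 : ¬ _ := fun h => hv (mem_filter.2 ⟨mem_univ v, h⟩)
        omega
    have hsum := hσ.trans (sum_le_sum fun v _ => hbound v)
    rw [sum_add_distrib, ← sum_filter, sum_const, smul_eq_mul, filter_mem_eq_inter,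
      univ_inter] at hsum
    have hb := sum_card_beatenVertices_le (beats := beats) hinj
    have hSlt : S.card < Fintype.card V := by
      have : Nonempty V := Fintype.card_pos_iff.1 (by omega)
      obtain ⟨v⟩ := this
      obtain ⟨w, hw⟩ := (G.degree_pos_iff_exists_adj v).1 (hdeg v)
      by_contra hlt
      have hall : S = univ :=
        (card_eq_iff_eq_univ S).1 (le_antisymm (card_le_univ S) (not_lt.1 hlt))
      exact hind v (hall ▸ mem_univ v) w (hall ▸ mem_univ w) hw
    have hk : k ≤ S.card := by
      by_contra hlt
      have : S.card + 1 ≤ k := by omega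
      have := Nat.mul_le_mul_left (2 * Fintype.card V) this
      have e : S.card * (2 * Fintype.card V + 1) = 2 * Fintype.card V * S.card + S.card := by ring
      rw [mul_add, mul_one] at this
      omega
    obtain ⟨I, hIS, hI⟩ := exists_subset_card_eq hk
    exact ⟨I, hI, fun u hu w hw => hind u (hIS hu) w (hIS hw)⟩
  · rintro ⟨I, rfl, hI⟩
    obtain ⟨σ, hσ⟩ := exists_seeding_forall_subset_Mset (beats := beats) hasymm Sum.inl
      Sum.inl_injective (incidentPlayers G (Fintype.card V ^ 2))
      (fun v => card_pos.1 (by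
        rw [card_incidentPlayers]; exact lt_of_lt_of_le (by positivity) (hdn v)))
      (fun v x hx => by
        rcases x with u | ⟨e, ℓ⟩
        · exact absurd hx (inl_notMem_incidentPlayers _ _)
        · exact (hve v e ℓ).1 (inr_mem_incidentPlayers.1 hx))
      inl_notMem_incidentPlayers I
      (fun u hu v hv huv x hx => by
        rcases x with w | ⟨e, ℓ⟩
        · exact absurd hx (inl_notMem_incidentPlayers _ _)
        · refine hve' u e ℓ fun hue => hI u hu v hv ?_
          have he := (Sym2.mem_and_mem_iff huv).1 ⟨hue, inr_mem_incidentPlayers.1 hx⟩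
          have := SimpleGraph.mem_edgeFinset.1 e.2
          rwa [he] at this)
    refine ⟨σ, ?_⟩
    calc
      2 * Fintype.card V * I.card = ∑ v ∈ I, 2 * Fintype.card V := by
        rw [sum_const, smul_eq_mul, mul_comm]
      _ ≤ ∑ v ∈ I, (wins beats σ (Sum.inl v) + 1 -
          (G.degree v * Fintype.card V ^ 2 - 2 * Fintype.card V)) := by
        refine sum_le_sum fun v hv => ?_
        have h1 := card_le_card (hσ v hv)
        rw [card_incidentPlayers] at h1
        have h2 := hdn v
        rw [wins]
        omega
      _ ≤ _ := sum_le_sum_of_subset (subset_univ I)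
end
end
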